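/- Let K be a number field and let Q be a quadratic form in n variables with coefficients in 𝓞_K which is regular, i.e. every element of 𝓞_K that is locally represented by Q over 𝓞_K lies in Q(𝓞_K). Then for every extension L/K of number fields of odd degree, Q(𝓞_L) ∩ 𝓞_K = Q(𝓞_K). -/

import Mathlib

open WithZero QuadraticMap in
theorem Valuation.map_mul_le_exp {K : Type*} [Field K] {v : Valuation K ℤᵐ⁰} {x y : K} {a b c : ℤ}
    (hx : v x ≤ exp a) (hy : v y ≤ exp b) (h : a + b ≤ c) : v (x * y) ≤ exp c := by
  rw [map_mul]
  exact (mul_le_mul' hx hy).trans (by rw [← exp_add]; exact exp_le_exp.2 h)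

open WithZero in
theorem WithZero.lt_exp_iff_le_exp_sub_one {x : ℤᵐ⁰} {a : ℤ} : x < exp a ↔ x ≤ exp (a - 1) := by
  rcases eq_or_ne x 0 with rfl | h
  · simp [-exp_sub]
  · rw [← exp_log h, exp_lt_exp, exp_le_exp]; lia

section Filtration

open WithZero QuadraticMap

variable {K V : Type*} [Field K] [AddCommGroup V] [Module K V]

/-- The vectors of the lattice `M` on which the quadratic form `Q` has order at least `j`. -/
def quadLevel (v : Valuation K ℤᵐ⁰) (Q : QuadraticForm K V) (M : Submodule v.integer V) (j : ℕ) :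
    Set V :=
  {x | x ∈ M ∧ v (Q x) ≤ exp (-(j : ℤ))}

variable {v : Valuation K ℤᵐ⁰} {Q : QuadraticForm K V} {M : Submodule v.integer V} {t : V →ₗ[K] K}
  {j : ℕ}

theorem Valuation.smul_mem_of_le_one {c : K} {x : V} (hc : v c ≤ 1) (hx : x ∈ M) : c • x ∈ M :=
  M.smul_mem ⟨c, hc⟩ hx

theorem smul_mem_quadLevel {c : K} {x : V} (hc : v c ≤ 1) (hx : x ∈ quadLevel v Q M j) :
    c • x ∈ quadLevel v Q M j := by
  refine ⟨Valuation.smul_mem_of_le_one hc hx.1, ?_⟩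
  rw [QuadraticMap.map_smul, smul_eq_mul]
  rw [← exp_zero] at hc
  exact Valuation.map_mul_le_exp (Valuation.map_mul_le_exp hc hc le_rfl) hx.2 (by simp)

theorem quadLevel_antitone {i : ℕ} (h : i ≤ j) : quadLevel v Q M j ⊆ quadLevel v Q M i :=
  fun _ hx => ⟨hx.1, hx.2.trans (exp_le_exp.2 (by lia))⟩

theorem neg_mem_quadLevel {x : V} (hx : x ∈ quadLevel v Q M j) : -x ∈ quadLevel v Q M j := by
  simpa using smul_mem_quadLevel (c := -1) (by simp) hx

theorem polar_le_of_add_mem {x y : V} (hx : x ∈ quadLevel v Q M j) (hy : y ∈ quadLevel v Q M j)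
    (hxy : x + y ∈ quadLevel v Q M j) : v (polar Q x y) ≤ exp (-(j : ℤ)) := by
  rw [polar]
  exact v.map_sub_le (v.map_sub_le hxy.2 hx.2) hy.2

theorem add_mem_quadLevel {x y : V} (hx : x ∈ quadLevel v Q M j) (hy : y ∈ quadLevel v Q M j)
    (h : v (polar Q x y) ≤ exp (-(j : ℤ))) : x + y ∈ quadLevel v Q M j := by
  refine ⟨M.add_mem hx.1 hy.1, ?_⟩
  rw [QuadraticMap.map_add Q]
  exact v.map_add_le (v.map_add_le hx.2 hy.2) h

/-- Newton iteration along a direction `z` in the kernel of `t`. -/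
theorem exists_quad_le_of_polar_eq {u z : V} (hu : u ∈ M) (htu : t u = 1)
    (hz : z ∈ quadLevel v Q M j) (htz : t z = 0) (hp : v (polar Q u z) = exp (-(j : ℤ)))
    (hQu : v (Q u) ≤ exp (-(j + 1 : ℤ))) (i : ℕ) :
    ∃ u' ∈ M, t u' = 1 ∧ v (polar Q u' z) = exp (-(j : ℤ)) ∧
      v (Q u') ≤ exp (-(j + 1 + i : ℤ)) := by
  induction i with
  | zero => exact ⟨u, hu, htu, hp, by simpa using hQu⟩
  | succ i ih =>
    obtain ⟨u, hu, htu, hp, hQu⟩ := ih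
    have hp0 : polar Q u z ≠ 0 := fun h => exp_ne_zero (by rw [← hp, h, map_zero])
    set h : K := -Q u / polar Q u z with hh
    have hvh : v h ≤ exp (-(1 + i : ℤ)) := by
      rw [hh, div_eq_mul_inv]
      exact Valuation.map_mul_le_exp (by rwa [Valuation.map_neg])
        (by rw [map_inv₀, hp, ← exp_neg]) (by lia)
    refine ⟨u + h • z, M.add_mem hu (Valuation.smul_mem_of_le_one
      (hvh.trans (by rw [← exp_zero]; exact exp_le_exp.2 (by lia))) hz.1), by simp [htu, htz], ?_, ?_⟩
    · rw [polar_add_left, polar_smul_left, polar_self, Valuation.map_add_eq_of_lt_left, hp]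
      rw [hp, smul_eq_mul, two_nsmul]
      refine (Valuation.map_mul_le_exp hvh (v.map_add_le hz.2 hz.2) le_rfl).trans_lt ?_
      exact exp_lt_exp.2 (by lia)
    · have : Q (u + h • z) = h * h * Q z := by
        rw [QuadraticMap.map_add Q, QuadraticMap.map_smul, polar_smul_right, smul_eq_mul, smul_eq_mul, hh]
        field_simp
        ring
      rw [this]
      exact Valuation.map_mul_le_exp (Valuation.map_mul_le_exp hvh hvh le_rfl) hz.2
        (by push_cast; lia)

/-- There is `J` such that `Q` has order less than `J` at every lattice vector with `t = 1`. -/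
def IsQuadBounded (v : Valuation K ℤᵐ⁰) (Q : QuadraticForm K V) (M : Submodule v.integer V)
    (t : V →ₗ[K] K) : Prop :=
  ∃ J : ℕ, ∀ u ∈ M, t u = 1 → ¬ v (Q u) ≤ exp (-(J : ℤ))

theorem IsQuadBounded.polar_le_of_eq_one (hb : IsQuadBounded v Q M t) (ht : ∀ x ∈ M, v (t x) ≤ 1)
    (hadd : ∀ x ∈ quadLevel v Q M j, ∀ y ∈ quadLevel v Q M j, x + y ∈ quadLevel v Q M j)
    {u z : V} (hu : u ∈ quadLevel v Q M (j + 1)) (htu : v (t u) = 1) (hz : z ∈ quadLevel v Q M j) :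
    v (polar Q u z) ≤ exp (-(j + 1 : ℤ)) := by
  have ht0 : t u ≠ 0 := fun h => by simp [h] at htu
  set u₁ := (t u)⁻¹ • u with hu₁
  have hu₁m : u₁ ∈ quadLevel v Q M (j + 1) := smul_mem_quadLevel (by simp [htu]) hu
  have htu₁ : t u₁ = 1 := by simp [hu₁, ht0]
  set z₁ := z + (-(t z)) • u₁ with hz₁
  have hz₁m : z₁ ∈ quadLevel v Q M j := hadd _ hz _
    (smul_mem_quadLevel (by simpa using ht z hz.1) (quadLevel_antitone (by lia) hu₁m))
  have htz₁ : t z₁ = 0 := by simp [hz₁, htu₁]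
  have hle : v (polar Q u₁ z₁) ≤ exp (-(j : ℤ)) :=
    polar_le_of_add_mem (quadLevel_antitone (by lia) hu₁m) hz₁m
      (hadd _ (quadLevel_antitone (by lia) hu₁m) _ hz₁m)
  have hlt : v (polar Q u₁ z₁) < exp (-(j : ℤ)) := by
    refine lt_of_le_of_ne hle fun h => ?_
    obtain ⟨J, hJ⟩ := hb
    obtain ⟨u', h1, h2, -, h3⟩ := exists_quad_le_of_polar_eq hu₁m.1 htu₁ hz₁m htz₁ h
      (by simpa using hu₁m.2) J
    exact hJ u' h1 h2 (h3.trans (exp_le_exp.2 (by lia)))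
  have key : polar Q u z = t u * (polar Q u₁ z₁ + t z * (Q u₁ + Q u₁)) := by
    have : u = t u • u₁ := by simp [hu₁, ht0]
    conv_lhs => rw [this]
    rw [polar_smul_left, hz₁, polar_add_right, polar_smul_right, polar_self]
    simp only [smul_eq_mul, two_nsmul]
    ring
  rw [key, map_mul, htu, one_mul]
  refine v.map_add_le ((lt_exp_iff_le_exp_sub_one.1 hlt).trans (exp_le_exp.2 (by lia))) ?_
  have h2 := hu₁m.2
  have h3 := ht z hz.1
  rw [← exp_zero] at h3
  exact Valuation.map_mul_le_exp h3 (v.map_add_le h2 h2) (by push_cast; lia)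

theorem IsQuadBounded.polar_le (hb : IsQuadBounded v Q M t) (ht : ∀ x ∈ M, v (t x) ≤ 1)
    (hadd : ∀ x ∈ quadLevel v Q M j, ∀ y ∈ quadLevel v Q M j, x + y ∈ quadLevel v Q M j)
    (hone : ∃ z ∈ quadLevel v Q M j, v (t z) = 1)
    {u z : V} (hu : u ∈ quadLevel v Q M (j + 1)) (hz : z ∈ quadLevel v Q M j) :
    v (polar Q u z) ≤ exp (-(j + 1 : ℤ)) := by
  by_cases htu : v (t u) = 1
  · exact hb.polar_le_of_eq_one ht hadd hu htu hz
  replace htu : v (t u) < 1 := lt_of_le_of_ne (ht u hu.1) htu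
  have hu' := quadLevel_antitone (Nat.le_succ j) hu
  have main : ∀ z ∈ quadLevel v Q M j, v (t z) = 1 → v (polar Q u z) ≤ exp (-(j + 1 : ℤ)) := by
    intro z hz htz
    by_contra hcon
    have hp : v (polar Q u z) = exp (-(j : ℤ)) := by
      refine le_antisymm (polar_le_of_add_mem hu' hz (hadd _ hu' _ hz)) ?_
      by_contra h
      rw [not_le, lt_exp_iff_le_exp_sub_one] at h
      exact hcon (h.trans (exp_le_exp.2 (by lia)))
    have hp0 : polar Q u z ≠ 0 := fun h => exp_ne_zero (by rw [← hp, h, map_zero])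
    set l : K := -Q z / polar Q u z with hl
    have hvl : v l ≤ 1 := by
      rw [hl, map_div₀, Valuation.map_neg, hp]
      exact div_le_one_of_le₀ hz.2 exp_pos.le
    have hz'm : z + l • u ∈ quadLevel v Q M (j + 1) := by
      refine ⟨M.add_mem hz.1 (Valuation.smul_mem_of_le_one hvl hu.1), ?_⟩
      have : Q (z + l • u) = l * l * Q u := by
        rw [QuadraticMap.map_add Q, QuadraticMap.map_smul, polar_smul_right, polar_comm _ z,
          smul_eq_mul, smul_eq_mul, hl]
        field_simp
        ring
      rw [this]
      rw [← exp_zero] at hvl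
      exact Valuation.map_mul_le_exp (Valuation.map_mul_le_exp hvl hvl le_rfl) hu.2 (by simp)
    have htz' : v (t (z + l • u)) = 1 := by
      rw [map_add, _root_.map_smul, smul_eq_mul, Valuation.map_add_eq_of_lt_left, htz]
      rw [htz, map_mul]
      exact mul_lt_one_of_nonneg_of_lt_one_right hvl zero_le htu
    have h1 := hb.polar_le_of_eq_one ht hadd hz'm htz' hu'
    rw [polar_add_left, polar_smul_left, polar_self, polar_comm _ z, smul_eq_mul, two_nsmul] at h1
    refine hcon ?_
    have h2 := hu.2
    have h3 : v (l * (Q u + Q u)) ≤ exp (-(j + 1 : ℤ)) := by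
      rw [← exp_zero] at hvl
      exact Valuation.map_mul_le_exp hvl (v.map_add_le h2 h2) (by simp)
    simpa using v.map_sub_le h1 h3
  by_cases htz : v (t z) = 1
  · exact main z hz htz
  obtain ⟨z₀, hz₀, htz₀⟩ := hone
  have h1 := main _ (hadd _ hz _ hz₀) (by
    rw [map_add, Valuation.map_add_eq_of_lt_right, htz₀]
    rw [htz₀]
    exact lt_of_le_of_ne (ht z hz.1) htz)
  rw [polar_add_right] at h1
  simpa using v.map_sub_le h1 (main z₀ hz₀ htz₀)

theorem IsQuadBounded.add_mem_succ (hb : IsQuadBounded v Q M t) (ht : ∀ x ∈ M, v (t x) ≤ 1)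
    (hadd : ∀ x ∈ quadLevel v Q M j, ∀ y ∈ quadLevel v Q M j, x + y ∈ quadLevel v Q M j)
    (hone : ∃ z ∈ quadLevel v Q M j, v (t z) = 1) :
    ∀ x ∈ quadLevel v Q M (j + 1), ∀ y ∈ quadLevel v Q M (j + 1),
      x + y ∈ quadLevel v Q M (j + 1) := fun _ hx _ hy =>
  add_mem_quadLevel hx hy
    (by simpa using hb.polar_le ht hadd hone hx (quadLevel_antitone (Nat.le_succ j) hy))

end Filtration

section Frames

open WithZero QuadraticMap

variable {K V : Type*} [Field K] [AddCommGroup V] [Module K V]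
  {v : Valuation K ℤᵐ⁰} {Q : QuadraticForm K V} {M : Submodule v.integer V} {j r : ℕ}

/-- A family in the `j`-th level whose images in the quotient by the next level are linearly
independent over the residue field. -/
def IsQuadFrame (v : Valuation K ℤᵐ⁰) (Q : QuadraticForm K V) (M : Submodule v.integer V) (j : ℕ)
    {r : ℕ} (y : Fin r → V) : Prop :=
  (∀ i, y i ∈ quadLevel v Q M j) ∧ ∀ c : Fin r → K, (∀ i, v (c i) ≤ 1) →
    ∑ i, c i • y i ∈ quadLevel v Q M (j + 1) → ∀ i, v (c i) < 1

/-- Ternary quadratic forms have nontrivial zeros modulo the maximal ideal. -/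
def HasTernaryZeros (v : Valuation K ℤᵐ⁰) : Prop :=
  ∀ a : Fin 3 → Fin 3 → K, (∀ i j, v (a i j) ≤ 1) → ∃ c : Fin 3 → K, (∀ i, v (c i) ≤ 1) ∧
    (∃ i, v (c i) = 1) ∧ v (∑ i, ∑ j, a i j * c i * c j) < 1

theorem HasTernaryZeros.not_isQuadFrame (h : HasTernaryZeros v) {p : K} (hp : v p = exp (-1))
    (hadd : ∀ x ∈ quadLevel v Q M j, ∀ y ∈ quadLevel v Q M j, x + y ∈ quadLevel v Q M j)
    (y : Fin 3 → V) : ¬ IsQuadFrame v Q M j y := by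
  rintro ⟨hy, hind⟩
  have hpj : v (p ^ j) = exp (-(j : ℤ)) := by
    rw [map_pow, hp, ← exp_nsmul]; simp
  have hpj0 : p ^ j ≠ 0 := fun h => exp_ne_zero (by rw [← hpj, h, map_zero])
  have hpol : ∀ i k, v (polar Q (y i) (y k)) ≤ exp (-(j : ℤ)) := fun i k =>
    polar_le_of_add_mem (hy i) (hy k) (hadd _ (hy i) _ (hy k))
  have hdiv : ∀ x : K, v x ≤ exp (-(j : ℤ)) → v (x / p ^ j) ≤ 1 := fun x hx => by
    rw [map_div₀, hpj]
    exact div_le_one_of_le₀ hx exp_pos.le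
  obtain ⟨c, hc, ⟨i, hi⟩, hlt⟩ := h
    (fun i k => if i = k then Q (y i) / p ^ j else if i < k then polar Q (y i) (y k) / p ^ j else 0)
    (fun i k => by
      split_ifs
      · exact hdiv _ (hy i).2
      · exact hdiv _ (hpol i k)
      · simp)
  refine (hind c hc ⟨M.sum_mem fun i _ => Valuation.smul_mem_of_le_one (hc i) (hy i).1, ?_⟩ i).ne hi
  rw [← exp_zero, lt_exp_iff_le_exp_sub_one] at hlt
  have := Valuation.map_mul_le_exp hpj.le hlt (c := -((j + 1 : ℕ) : ℤ)) (by push_cast; lia)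
  convert this using 2
  simp only [Fin.sum_univ_three, QuadraticMap.map_add Q, QuadraticMap.map_smul, polar_add_left,
    polar_smul_left, polar_smul_right, smul_eq_mul]
  simp
  field_simp
  ring

theorem HasTernaryZeros.exists_isQuadFrame (h : HasTernaryZeros v) {p : K} (hp : v p = exp (-1))
    (hadd : ∀ x ∈ quadLevel v Q M j, ∀ y ∈ quadLevel v Q M j, x + y ∈ quadLevel v Q M j)
    (hadd' : ∀ x ∈ quadLevel v Q M (j + 1), ∀ y ∈ quadLevel v Q M (j + 1),
      x + y ∈ quadLevel v Q M (j + 1)) :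
    ∃ r < 3, ∃ y : Fin r → V, IsQuadFrame v Q M j y ∧ ∀ x ∈ quadLevel v Q M j,
      ∃ c : Fin r → K, (∀ i, v (c i) ≤ 1) ∧ x - ∑ i, c i • y i ∈ quadLevel v Q M (j + 1) := by
  have hex : ∃ r < 3, (∃ y : Fin r → V, IsQuadFrame v Q M j y) ∧
      ¬ ∃ y : Fin (r + 1) → V, IsQuadFrame v Q M j y := by
    by_contra! hcon
    have h0 : ∃ y : Fin 0 → V, IsQuadFrame v Q M j y := ⟨Fin.elim0, by simp [IsQuadFrame]⟩
    obtain ⟨y, hy⟩ := hcon 2 (by simp) (hcon 1 (by simp) (hcon 0 (by simp) h0))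
    exact h.not_isQuadFrame hp hadd y hy
  obtain ⟨r, hr, ⟨y, hy⟩, hn⟩ := hex
  refine ⟨r, hr, y, hy, fun x hx => ?_⟩
  push Not at hn
  have := hn (Fin.cons x y)
  simp only [IsQuadFrame, not_and, not_forall, not_lt] at this
  obtain ⟨c, hc, hm, i, hi⟩ := this (Fin.cases (by simpa using hx) (by simpa using hy.1))
  rw [Fin.sum_univ_succ] at hm
  simp only [Fin.cons_zero, Fin.cons_succ] at hm
  by_cases hc0 : v (c 0) < 1
  · exfalso
    have hcx : c 0 • x ∈ quadLevel v Q M (j + 1) := by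
      refine ⟨Valuation.smul_mem_of_le_one (hc 0) hx.1, ?_⟩
      rw [← exp_zero, lt_exp_iff_le_exp_sub_one] at hc0
      rw [QuadraticMap.map_smul, smul_eq_mul]
      exact Valuation.map_mul_le_exp (Valuation.map_mul_le_exp hc0 hc0 le_rfl) hx.2
        (by push_cast; lia)
    have h1 := hadd' _ hm _ (neg_mem_quadLevel hcx)
    rw [add_neg_cancel_comm] at h1
    have h2 := hy.2 (fun i => c i.succ) (fun i => hc _) h1
    induction i using Fin.cases with
    | zero => exact absurd hc0 hi.not_gt
    | succ i => exact absurd (h2 i) hi.not_gt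
  · have hc1 : v (c 0) = 1 := le_antisymm (hc 0) (not_lt.1 hc0)
    have hne : c 0 ≠ 0 := fun h => by simp [h] at hc1
    refine ⟨fun i => -((c 0)⁻¹ * c i.succ), fun i => by simpa [hc1] using hc i.succ, ?_⟩
    have h1 := smul_mem_quadLevel (c := (c 0)⁻¹) (by simp [hc1]) hm
    convert h1 using 1
    simp [smul_add, smul_smul, hne, Finset.smul_sum]

variable {L N : Type*} [Field L] [Algebra K L] [AddCommGroup N] [Module L N] [Module K N]
  {w : Valuation L ℤᵐ⁰} {QL : QuadraticForm L N} {ι : V →ₗ[K] N} {e : ℕ}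

/-- Monic quadratic polynomials over `K` with a root in the residue field of `w` have a root in the
residue field of `v`. -/
def ResidueQuadraticClosed (v : Valuation K ℤᵐ⁰) (w : Valuation L ℤᵐ⁰) : Prop :=
  ∀ β γ : K, ∀ b : L, v β ≤ 1 → v γ ≤ 1 → w b ≤ 1 →
    w (b ^ 2 + algebraMap K L β * b + algebraMap K L γ) < 1 →
    ∃ c : K, v c ≤ 1 ∧ v (c ^ 2 + β * c + γ) < 1

theorem polar_map_eq (hQ : ∀ x, QL (ι x) = algebraMap K L (Q x)) (x y : V) :
    polar QL (ι x) (ι y) = algebraMap K L (polar Q x y) := by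
  simp [polar, ← hQ]

theorem quad_eq_of_notMem {x : V} (hx : x ∈ quadLevel v Q M j) (hn : x ∉ quadLevel v Q M (j + 1)) :
    v (Q x) = exp (-(j : ℤ)) := by
  refine le_antisymm hx.2 (le_of_not_gt fun h => hn ⟨hx.1, ?_⟩)
  rw [lt_exp_iff_le_exp_sub_one] at h
  exact h.trans (exp_le_exp.2 (by push_cast; lia))

theorem quad_pair_eq (hw : ∀ x, w (algebraMap K L x) = v x ^ e)
    (hQ : ∀ x, QL (ι x) = algebraMap K L (Q x)) (hres : ResidueQuadraticClosed v w)
    (hadd : ∀ x ∈ quadLevel v Q M j, ∀ y ∈ quadLevel v Q M j, x + y ∈ quadLevel v Q M j)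
    {x y : V} (hx : x ∈ quadLevel v Q M j) (hy : y ∈ quadLevel v Q M j)
    (hny : y ∉ quadLevel v Q M (j + 1))
    (hn : ∀ c : K, v c ≤ 1 → x + c • y ∉ quadLevel v Q M (j + 1)) {b b' : L} (hb : w b' ≤ w b) :
    w (QL (b • ι x + b' • ι y)) = exp (-(j : ℤ)) ^ e * w b ^ 2 := by
  rcases eq_or_ne b 0 with rfl | hb0
  · have : b' = 0 := by simpa using hb
    simp [this]
  have hQy := quad_eq_of_notMem hy hny
  have hQy0 : Q y ≠ 0 := fun h => exp_ne_zero (by rw [← hQy, h, map_zero])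
  have hdiv : ∀ x : K, v x ≤ exp (-(j : ℤ)) → v (x / Q y) ≤ 1 := fun x hx => by
    rw [map_div₀, hQy]
    exact div_le_one_of_le₀ hx exp_pos.le
  have hpol := polar_le_of_add_mem hx hy (hadd _ hx _ hy)
  set u := b' / b with hu
  have hwu : w u ≤ 1 := by
    rw [hu, map_div₀]
    exact div_le_one_of_le₀ hb zero_le
  have hb' : b' = b * u := by rw [hu]; field_simp
  set β := polar Q x y / Q y with hβ
  set γ := Q x / Q y with hγ
  have hwle : ∀ x : K, v x ≤ 1 → w (algebraMap K L x) ≤ 1 := fun x hx => by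
    rw [hw]; exact pow_le_one₀ zero_le hx
  have hval : w (u ^ 2 + algebraMap K L β * u + algebraMap K L γ) = 1 := by
    refine le_antisymm (w.map_add_le (w.map_add_le ?_ ?_) (hwle _ (hdiv _ hx.2)))
      (le_of_not_gt fun hlt => ?_)
    · rw [map_pow]; exact pow_le_one₀ zero_le hwu
    · rw [map_mul]; exact mul_le_one₀ (hwle _ (hdiv _ hpol)) zero_le hwu
    obtain ⟨c, hc, hlt⟩ := hres β γ u (hdiv _ hpol) (hdiv _ hx.2) hwu hlt
    refine hn c hc ⟨M.add_mem hx.1 (Valuation.smul_mem_of_le_one hc hy.1), ?_⟩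
    have h2 : Q (x + c • y) = Q y * (c ^ 2 + β * c + γ) := by
      rw [QuadraticMap.map_add Q, QuadraticMap.map_smul, polar_smul_right, smul_eq_mul, smul_eq_mul,
        hβ, hγ]
      field_simp
      ring
    rw [h2]
    rw [← exp_zero, lt_exp_iff_le_exp_sub_one] at hlt
    exact Valuation.map_mul_le_exp hQy.le hlt (by push_cast; lia)
  have h3 : QL (b • ι x + b' • ι y) =
      algebraMap K L (Q y) * (b ^ 2 * (u ^ 2 + algebraMap K L β * u + algebraMap K L γ)) := by
    rw [QuadraticMap.map_add QL, QuadraticMap.map_smul, QuadraticMap.map_smul, polar_smul_left,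
      polar_smul_right, polar_map_eq hQ, hQ, hQ, hb', hβ, hγ, map_div₀, map_div₀]
    have : algebraMap K L (Q y) ≠ 0 := by simpa using hQy0
    simp only [smul_eq_mul]
    field_simp
    ring
  rw [h3, map_mul, map_mul, hval, mul_one, map_pow, hw, hQy]

theorem IsQuadFrame.exists_quad_eq (hw : ∀ x, w (algebraMap K L x) = v x ^ e)
    (hQ : ∀ x, QL (ι x) = algebraMap K L (Q x)) (hres : ResidueQuadraticClosed v w)
    (hadd : ∀ x ∈ quadLevel v Q M j, ∀ y ∈ quadLevel v Q M j, x + y ∈ quadLevel v Q M j)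
    (hr : r < 3) {y : Fin r → V} (hy : IsQuadFrame v Q M j y) (b : Fin r → L) :
    ∃ a : ℤᵐ⁰, (∀ i, w (b i) ≤ a) ∧ w (QL (∑ i, b i • ι (y i))) = exp (-(j : ℤ)) ^ e * a ^ 2 := by
  obtain ⟨hym, hy⟩ := hy
  interval_cases r
  · exact ⟨0, by simp, by simp⟩
  · refine ⟨w (b 0), fun i => by rw [Subsingleton.elim i 0], ?_⟩
    have : y 0 ∉ quadLevel v Q M (j + 1) := fun h => by
      simpa using hy 1 (by simp) (by simpa using h) 0
    simp only [Finset.univ_unique, Fin.default_eq_zero, Fin.isValue, Finset.sum_singleton]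
    rw [QuadraticMap.map_smul, hQ, smul_eq_mul, map_mul, map_mul, hw,
      quad_eq_of_notMem (hym 0) this, mul_comm, pow_two]
  · have h0 : y 0 ∉ quadLevel v Q M (j + 1) := fun h => by
      simpa using hy ![1, 0] (by simp) (by simpa using h) 0
    have h1 : y 1 ∉ quadLevel v Q M (j + 1) := fun h => by
      simpa using hy ![0, 1] (by simp) (by simpa using h) 1
    rcases le_total (w (b 1)) (w (b 0)) with hle | hle
    · refine ⟨w (b 0), by simpa using hle, ?_⟩
      rw [Fin.sum_univ_two]
      refine quad_pair_eq hw hQ hres hadd (hym 0) (hym 1) h1 (fun c hc h => ?_) hle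
      simpa using hy ![1, c] (by simpa using hc) (by simpa using h) 0
    · refine ⟨w (b 1), by simpa using hle, ?_⟩
      rw [Fin.sum_univ_two, add_comm]
      refine quad_pair_eq hw hQ hres hadd (hym 1) (hym 0) h0 (fun c hc h => ?_) hle
      simpa using hy ![c, 1] (by simpa using hc) (by simpa [add_comm] using h) 1

end Frames

section Descent

open WithZero QuadraticMap

variable {K V : Type*} [Field K] [AddCommGroup V] [Module K V]
  {v : Valuation K ℤᵐ⁰} {Q : QuadraticForm K V} {M : Submodule v.integer V} {t : V →ₗ[K] K} {j : ℕ}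
  {L N : Type*} [Field L] [Algebra K L] [AddCommGroup N] [Module L N] [Module K N]
  {w : Valuation L ℤᵐ⁰} {QL : QuadraticForm L N} {tL : N →ₗ[L] L} {ι : V →ₗ[K] N} {e : ℕ}

theorem valuation_algebraMap_le_exp (hw : ∀ x, w (algebraMap K L x) = v x ^ e) {x : K} {k : ℤ}
    (hx : v x ≤ exp k) : w (algebraMap K L x) ≤ exp (e * k) := by
  rw [hw, ← nsmul_eq_mul, exp_nsmul]
  exact pow_le_pow_left₀ zero_le hx e

theorem integer_smul_eq (c : w.integer) (x : N) : c • x = (c : L) • x := rfl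

theorem polar_le_of_mem_span (hw : ∀ x, w (algebraMap K L x) = v x ^ e)
    (hQ : ∀ x, QL (ι x) = algebraMap K L (Q x)) {S T : Set V} {k : ℤ}
    (h : ∀ x ∈ S, ∀ y ∈ T, v (polar Q x y) ≤ exp k) {x y : N}
    (hx : x ∈ Submodule.span w.integer (ι '' S)) (hy : y ∈ Submodule.span w.integer (ι '' T)) :
    w (polar QL x y) ≤ exp (e * k) := by
  induction hx, hy using Submodule.span_induction₂ with
  | mem_mem x y hx hy =>
    obtain ⟨x, hx, rfl⟩ := hx
    obtain ⟨y, hy, rfl⟩ := hy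
    rw [polar_map_eq hQ]
    exact valuation_algebraMap_le_exp hw (h x hx y hy)
  | zero_left => simp
  | zero_right => simp
  | add_left _ _ _ _ _ _ h1 h2 => rw [polar_add_left]; exact w.map_add_le h1 h2
  | add_right _ _ _ _ _ _ h1 h2 => rw [polar_add_right]; exact w.map_add_le h1 h2
  | smul_left c _ _ _ _ h =>
    rw [integer_smul_eq, polar_smul_left, smul_eq_mul]
    exact Valuation.map_mul_le_exp (c.2.trans exp_zero.ge) h (by simp)
  | smul_right c _ _ _ _ h =>
    rw [integer_smul_eq, polar_smul_right, smul_eq_mul]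
    exact Valuation.map_mul_le_exp (c.2.trans exp_zero.ge) h (by simp)

theorem quad_le_of_mem_span (hw : ∀ x, w (algebraMap K L x) = v x ^ e)
    (hQ : ∀ x, QL (ι x) = algebraMap K L (Q x))
    (hadd : ∀ x ∈ quadLevel v Q M j, ∀ y ∈ quadLevel v Q M j, x + y ∈ quadLevel v Q M j) {x : N}
    (hx : x ∈ Submodule.span w.integer (ι '' quadLevel v Q M j)) :
    w (QL x) ≤ exp (e * -(j : ℤ)) := by
  induction hx using Submodule.span_induction with
  | mem x hx =>
    obtain ⟨x, hx, rfl⟩ := hx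
    rw [hQ]
    exact valuation_algebraMap_le_exp hw hx.2
  | zero => simp
  | add x y hx hy h1 h2 =>
    rw [QuadraticMap.map_add QL]
    exact w.map_add_le (w.map_add_le h1 h2) (polar_le_of_mem_span hw hQ
      (fun x hx y hy => polar_le_of_add_mem hx hy (hadd x hx y hy)) hx hy)
  | smul c x hx h =>
    rw [integer_smul_eq, QuadraticMap.map_smul, smul_eq_mul]
    have hc : w (c : L) ≤ exp 0 := c.2.trans exp_zero.ge
    exact Valuation.map_mul_le_exp (Valuation.map_mul_le_exp hc hc le_rfl) h (by simp)

theorem linear_le_of_mem_span (hw : ∀ x, w (algebraMap K L x) = v x ^ e)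
    (ht : ∀ x, tL (ι x) = algebraMap K L (t x)) {S : Set V} {k : ℤ} (h : ∀ x ∈ S, v (t x) ≤ exp k)
    {x : N} (hx : x ∈ Submodule.span w.integer (ι '' S)) : w (tL x) ≤ exp (e * k) := by
  induction hx using Submodule.span_induction with
  | mem x hx =>
    obtain ⟨x, hx, rfl⟩ := hx
    rw [ht]
    exact valuation_algebraMap_le_exp hw (h x hx)
  | zero => simp
  | add x y _ _ h1 h2 => rw [_root_.map_add]; exact w.map_add_le h1 h2
  | smul c x _ h =>
    rw [integer_smul_eq, _root_.map_smul, smul_eq_mul]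
    exact Valuation.map_mul_le_exp (c.2.trans exp_zero.ge) h (by simp)

theorem smul_mem_span_integer {S : Set N} {c : L} (hc : w c ≤ 1) {x : N}
    (hx : x ∈ Submodule.span w.integer S) : c • x ∈ Submodule.span w.integer S :=
  Submodule.smul_mem _ (⟨c, hc⟩ : w.integer) hx

theorem exists_sub_mem_span [IsScalarTower K L N] (hw : ∀ x, w (algebraMap K L x) = v x ^ e)
    {S T : Set V} {r : ℕ} {y : Fin r → V}
    (h : ∀ x ∈ S, ∃ c : Fin r → K, (∀ i, v (c i) ≤ 1) ∧ x - ∑ i, c i • y i ∈ T) {x : N}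
    (hx : x ∈ Submodule.span w.integer (ι '' S)) :
    ∃ b : Fin r → L, (∀ i, w (b i) ≤ 1) ∧
      x - ∑ i, b i • ι (y i) ∈ Submodule.span w.integer (ι '' T) := by
  induction hx using Submodule.span_induction with
  | mem x hx =>
    obtain ⟨x, hx, rfl⟩ := hx
    obtain ⟨c, hc, hm⟩ := h x hx
    refine ⟨fun i => algebraMap K L (c i), fun i => by
      rw [hw]; exact pow_le_one₀ zero_le (hc i), Submodule.subset_span ⟨_, hm, ?_⟩⟩
    simp [algebraMap_smul]
  | zero => exact ⟨0, by simp, by simp⟩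
  | add x y _ _ h1 h2 =>
    obtain ⟨b, hb, h1⟩ := h1
    obtain ⟨b', hb', h2⟩ := h2
    refine ⟨b + b', fun i => w.map_add_le (hb i) (hb' i), ?_⟩
    convert Submodule.add_mem _ h1 h2 using 1
    simp only [Pi.add_apply, add_smul, Finset.sum_add_distrib]
    abel
  | smul c x _ h =>
    obtain ⟨b, hb, h⟩ := h
    refine ⟨fun i => c * b i, fun i => ?_, ?_⟩
    · rw [map_mul]; exact mul_le_one₀ c.2 zero_le (hb i)
    · convert Submodule.smul_mem _ c h using 1
      simp [integer_smul_eq, smul_sub, Finset.smul_sum, mul_smul]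

theorem polar_sum_smul_le {r : ℕ} {b : Fin r → L} {y : Fin r → N} {x : N} {a g : ℤᵐ⁰}
    (hb : ∀ i, w (b i) ≤ a) (hg : ∀ i, w (polar QL (y i) x) ≤ g) :
    w (polar QL (∑ i, b i • y i) x) ≤ a * g := by
  have : polar QL (∑ i, b i • y i) x = ∑ i, b i * polar QL (y i) x := by
    rw [← QuadraticMap.polarBilin_apply_apply, map_sum, LinearMap.sum_apply]
    simp
  rw [this]
  refine w.map_sum_le fun i _ => ?_
  rw [map_mul]
  exact mul_le_mul' (hb i) (hg i)

theorem exists_eq_one_of_mem_span [IsScalarTower K L N] (he : 0 < e)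
    (hw : ∀ x, w (algebraMap K L x) = v x ^ e) (hQ : ∀ x, QL (ι x) = algebraMap K L (Q x))
    (htL : ∀ x, tL (ι x) = algebraMap K L (t x)) (ht : ∀ x ∈ M, v (t x) ≤ 1)
    (hT : HasTernaryZeros v) (hres : ResidueQuadraticClosed v w) {p : K} (hp : v p = exp (-1))
    (hadd : ∀ x ∈ quadLevel v Q M j, ∀ y ∈ quadLevel v Q M j, x + y ∈ quadLevel v Q M j)
    (hadd' : ∀ x ∈ quadLevel v Q M (j + 1), ∀ y ∈ quadLevel v Q M (j + 1),
      x + y ∈ quadLevel v Q M (j + 1))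
    (hpol : ∀ x ∈ quadLevel v Q M (j + 1), ∀ y ∈ quadLevel v Q M j,
      v (polar Q x y) ≤ exp (-(j + 1 : ℤ)))
    {x : N} (hx : x ∈ Submodule.span w.integer (ι '' quadLevel v Q M j)) (hx0 : QL x = 0)
    (hx1 : tL x = 1) : ∃ z ∈ quadLevel v Q M (j + 1), v (t z) = 1 := by
  by_contra! hcon
  obtain ⟨r, hr, y, hy, hspan⟩ := hT.exists_isQuadFrame hp hadd hadd'
  obtain ⟨b, -, hs⟩ := exists_sub_mem_span hw hspan hx
  obtain ⟨a, hba, ha⟩ := hy.exists_quad_eq hw hQ hres hadd hr b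
  set Y := ∑ i, b i • ι (y i) with hY
  set s := x - Y with hsdef
  have hxs : x = Y + s := by simp [hsdef]
  have h1 := quad_le_of_mem_span hw hQ hadd' hs
  have h2 : w (polar QL Y s) ≤ a * exp (e * -(j + 1 : ℤ)) := by
    refine polar_sum_smul_le hba fun i => ?_
    rw [polar_comm]
    exact polar_le_of_mem_span hw hQ hpol hs (Submodule.subset_span ⟨_, hy.1 i, rfl⟩)
  have ha1 : a < 1 := by
    by_contra! hge
    have hQY : QL Y = -(QL s + polar QL Y s) := by
      rw [hxs, QuadraticMap.map_add QL] at hx0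
      linear_combination hx0
    have h3 : w (QL Y) ≤ a * exp (e * -(j + 1 : ℤ)) := by
      rw [hQY, Valuation.map_neg]
      exact w.map_add_le (h1.trans (by
        push_cast
        exact le_mul_of_one_le_left zero_le hge)) h2
    have ha0 : a ≠ 0 := (zero_lt_one.trans_le hge).ne'
    rw [ha, ← exp_nsmul, ← exp_log ha0, ← exp_nsmul, ← exp_add, ← exp_add, exp_le_exp] at h3
    have h4 : 0 ≤ a.log := le_log_of_exp_le (by simpa using hge)
    simp only [nsmul_eq_mul] at h3
    push_cast at h3
    have : (0 : ℤ) < e := by exact_mod_cast he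
    linarith
  have h3 : w (tL Y) < 1 := by
    rw [hY, map_sum]
    refine w.map_sum_lt one_ne_zero fun i _ => ?_
    rw [_root_.map_smul, smul_eq_mul, map_mul, htL, hw]
    exact mul_lt_one_of_lt_of_le ((hba i).trans_lt ha1) (pow_le_one₀ zero_le (ht _ (hy.1 i).1))
  have h4 : w (tL s) < 1 := by
    have := linear_le_of_mem_span hw htL (k := -1) (fun z hz => by
      have := lt_of_le_of_ne (ht z hz.1) (hcon z hz)
      rwa [← exp_zero, lt_exp_iff_le_exp_sub_one] at this) hs
    refine this.trans_lt ?_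
    rw [← exp_zero, exp_lt_exp]
    have : (0 : ℤ) < e := by exact_mod_cast he
    lia
  have h5 := w.map_add_lt h3 h4
  rw [← _root_.map_add, ← hxs, hx1, map_one] at h5
  exact lt_irrefl _ h5

theorem mem_span_quadLevel_succ [IsScalarTower K L N] (he : Odd e)
    (hw : ∀ x, w (algebraMap K L x) = v x ^ e) (hQ : ∀ x, QL (ι x) = algebraMap K L (Q x))
    (hT : HasTernaryZeros v) (hres : ResidueQuadraticClosed v w) {p : K} (hp : v p = exp (-1))
    (hadd : ∀ x ∈ quadLevel v Q M j, ∀ y ∈ quadLevel v Q M j, x + y ∈ quadLevel v Q M j)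
    (hadd' : ∀ x ∈ quadLevel v Q M (j + 1), ∀ y ∈ quadLevel v Q M (j + 1),
      x + y ∈ quadLevel v Q M (j + 1))
    (hadd'' : ∀ x ∈ quadLevel v Q M (j + 2), ∀ y ∈ quadLevel v Q M (j + 2),
      x + y ∈ quadLevel v Q M (j + 2))
    (hpol : ∀ x ∈ quadLevel v Q M (j + 1), ∀ y ∈ quadLevel v Q M j,
      v (polar Q x y) ≤ exp (-(j + 1 : ℤ)))
    (hpol' : ∀ x ∈ quadLevel v Q M (j + 2), ∀ y ∈ quadLevel v Q M (j + 1),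
      v (polar Q x y) ≤ exp (-(j + 2 : ℤ)))
    {x : N} (hx : x ∈ Submodule.span w.integer (ι '' quadLevel v Q M j)) (hx0 : QL x = 0) :
    x ∈ Submodule.span w.integer (ι '' quadLevel v Q M (j + 1)) := by
  obtain ⟨r, hr, y, hy, hspan⟩ := hT.exists_isQuadFrame hp hadd hadd'
  obtain ⟨r', hr', z, hz, hspan'⟩ := hT.exists_isQuadFrame hp hadd' hadd''
  obtain ⟨b, -, hs₁⟩ := exists_sub_mem_span hw hspan hx
  obtain ⟨c, hc, hs⟩ := exists_sub_mem_span hw hspan' hs₁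
  obtain ⟨a, hba, ha⟩ := hy.exists_quad_eq hw hQ hres hadd hr b
  obtain ⟨d, hcd, hd⟩ := hz.exists_quad_eq hw hQ hres hadd' hr' c
  set Y := ∑ i, b i • ι (y i) with hY
  set Z := ∑ i, c i • ι (z i) with hZ
  set s := x - Y - Z with hsdef
  have hxs : x = Y + Z + s := by simp [hsdef]
  have hmono : Submodule.span w.integer (ι '' quadLevel v Q M (j + 2)) ≤
      Submodule.span w.integer (ι '' quadLevel v Q M (j + 1)) :=
    Submodule.span_mono (Set.image_mono (quadLevel_antitone (Nat.le_succ _)))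
  have hymem : ∀ i, ι (y i) ∈ Submodule.span w.integer (ι '' quadLevel v Q M j) := fun i =>
    Submodule.subset_span ⟨_, hy.1 i, rfl⟩
  have hzmem : ∀ i, ι (z i) ∈ Submodule.span w.integer (ι '' quadLevel v Q M (j + 1)) := fun i =>
    Submodule.subset_span ⟨_, hz.1 i, rfl⟩
  have hZm : Z ∈ Submodule.span w.integer (ι '' quadLevel v Q M (j + 1)) :=
    Submodule.sum_mem _ fun i _ => smul_mem_span_integer (hc i) (hzmem i)
  have hYs : w (polar QL Y s) ≤ a * exp (e * -(j + 1 : ℤ)) := by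
    refine polar_sum_smul_le hba fun i => ?_
    rw [polar_comm]
    exact polar_le_of_mem_span hw hQ hpol (hmono hs) (hymem i)
  have hYZ : w (polar QL Y Z) ≤ a * (d * exp (e * -(j + 1 : ℤ))) := by
    refine polar_sum_smul_le hba fun i => ?_
    rw [polar_comm]
    exact polar_sum_smul_le hcd fun k => polar_le_of_mem_span hw hQ hpol (hzmem k) (hymem i)
  have hZs : w (polar QL Z s) ≤ exp (e * -(j + 2 : ℤ)) := by
    rw [polar_comm]
    exact polar_le_of_mem_span hw hQ hpol' hs hZm
  have hss : w (QL s) ≤ exp (e * -(j + 2 : ℤ)) := by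
    simpa using quad_le_of_mem_span hw hQ hadd'' hs
  have hsum : QL Y + QL Z + polar QL Y Z + QL s + polar QL Y s + polar QL Z s = 0 := by
    rw [← hx0, hxs, QuadraticMap.map_add QL (Y + Z), QuadraticMap.map_add QL Y, polar_add_left]
    ring
  have hale : a ≤ exp (-(e : ℤ)) := by
    by_contra! hlt
    have ha0 : a ≠ 0 := (exp_pos.trans hlt).ne'
    obtain ⟨α, rfl⟩ : ∃ α, a = exp α := ⟨_, (exp_log ha0).symm⟩
    rw [exp_lt_exp] at hlt
    simp only [← exp_nsmul, nsmul_eq_mul, ← exp_add] at ha hYs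
    have he0 : (0 : ℤ) < e := by exact_mod_cast he.pos
    push_cast at ha hd
    have hdom : w (QL Z) < w (QL Y) → w (polar QL Y Z) < w (QL Y) → False := fun h1 h2 => by
      have h3 : w (QL Y) = w (-(QL Z + polar QL Y Z + QL s + polar QL Y s + polar QL Z s)) := by
        congr 1
        linear_combination hsum
      rw [Valuation.map_neg] at h3
      refine (w.map_add_lt (w.map_add_lt (w.map_add_lt (w.map_add_lt h1 h2) (hss.trans_lt ?_))
        (hYs.trans_lt ?_)) (hZs.trans_lt ?_)).ne' h3 <;>
      · rw [ha, exp_lt_exp]; linarith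
    rcases eq_or_ne d 0 with rfl | hd0
    · refine hdom ?_ ?_
      · rw [hd, ha]; simp [-exp_add]
      · rw [ha]; exact hYZ.trans_lt (by simp [-exp_add])
    obtain ⟨δ, rfl⟩ : ∃ δ, d = exp δ := ⟨_, (exp_log hd0).symm⟩
    simp only [← exp_nsmul, nsmul_eq_mul, ← exp_add] at hd hYZ
    push_cast at hd
    obtain ⟨m, hm⟩ := he
    have hm' : (e : ℤ) = 2 * m + 1 := by exact_mod_cast hm
    rcases lt_or_ge (2 * δ - e) (2 * α) with hcase | hcase
    · refine hdom ?_ ?_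
      · rw [hd, ha, exp_lt_exp]; linarith
      · rw [ha]; refine hYZ.trans_lt ?_; rw [exp_lt_exp]; linarith
    · have hcase' : 2 * α < 2 * δ - e := by lia
      have h3 : w (QL Z) = w (-(QL Y + polar QL Y Z + QL s + polar QL Y s + polar QL Z s)) := by
        congr 1
        linear_combination hsum
      rw [Valuation.map_neg] at h3
      refine (w.map_add_lt (w.map_add_lt (w.map_add_lt (w.map_add_lt ?_ (hYZ.trans_lt ?_))
        (hss.trans_lt ?_)) (hYs.trans_lt ?_)) (hZs.trans_lt ?_)).ne' h3
      · rw [hd, ha, exp_lt_exp]; linarith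
      all_goals rw [hd, exp_lt_exp]; linarith
  rw [hxs]
  refine add_mem (add_mem (Submodule.sum_mem _ fun i _ => ?_) hZm) (hmono hs)
  have hp0 : p ≠ 0 := fun h => exp_ne_zero (by rw [← hp, h, map_zero])
  have hpL : algebraMap K L p ≠ 0 := by simpa using hp0
  have hwp : w (algebraMap K L p) = exp (-(e : ℤ)) := by
    rw [hw, hp, ← exp_nsmul]; simp
  have hpy : p • y i ∈ quadLevel v Q M (j + 1) := by
    refine ⟨Valuation.smul_mem_of_le_one (by
      rw [hp, ← exp_zero]; exact exp_le_exp.2 (by simp))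
      (hy.1 i).1, ?_⟩
    rw [QuadraticMap.map_smul, smul_eq_mul]
    exact Valuation.map_mul_le_exp (Valuation.map_mul_le_exp hp.le hp.le le_rfl) (hy.1 i).2
      (by push_cast; lia)
  have : b i • ι (y i) = (b i / algebraMap K L p) • ι (p • y i) := by
    rw [_root_.map_smul, ← algebraMap_smul L p, smul_smul, div_mul_cancel₀ _ hpL]
  rw [this]
  refine smul_mem_span_integer ?_ (Submodule.subset_span ⟨_, hpy, rfl⟩)
  rw [map_div₀, hwp]
  exact div_le_one_of_le₀ ((hba i).trans hale) exp_pos.le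

/-- If an extension of valued fields with odd ramification index has a zero of `QL` in the lattice
spanned by `M` on which `tL` is `1`, then `M` contains approximate zeros of `Q` of any order on
which `t` is `1`. -/
theorem exists_quad_le_of_extension [IsScalarTower K L N] (he : Odd e)
    (hw : ∀ x, w (algebraMap K L x) = v x ^ e) (hQ : ∀ x, QL (ι x) = algebraMap K L (Q x))
    (htL : ∀ x, tL (ι x) = algebraMap K L (t x)) (ht : ∀ x ∈ M, v (t x) ≤ 1)
    (hQM : ∀ x ∈ M, v (Q x) ≤ 1) (h1 : ∃ x ∈ M, v (t x) = 1)
    (hT : HasTernaryZeros v) (hres : ResidueQuadraticClosed v w) {p : K} (hp : v p = exp (-1))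
    {x : N} (hx : x ∈ Submodule.span w.integer (ι '' M)) (hx0 : QL x = 0) (hx1 : tL x = 1) (J : ℕ) :
    ∃ u ∈ M, t u = 1 ∧ v (Q u) ≤ exp (-(J : ℤ)) := by
  by_contra! hcon
  have hb : IsQuadBounded v Q M t := ⟨J, fun u hu htu => not_le.2 (hcon u hu htu)⟩
  have key : ∀ j : ℕ,
      (∀ x ∈ quadLevel v Q M j, ∀ y ∈ quadLevel v Q M j, x + y ∈ quadLevel v Q M j) ∧
      (∃ z ∈ quadLevel v Q M j, v (t z) = 1) ∧
      x ∈ Submodule.span w.integer (ι '' quadLevel v Q M j) := by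
    intro j
    induction j with
    | zero =>
      have : quadLevel v Q M 0 = M := by
        ext y
        simpa [quadLevel] using hQM y
      rw [this]
      exact ⟨fun x hx y hy => M.add_mem hx hy, h1, hx⟩
    | succ j ih =>
      obtain ⟨hadd, hone, hxj⟩ := ih
      have hadd' := hb.add_mem_succ ht hadd hone
      have hpol := fun x hx y hy => hb.polar_le ht hadd hone (u := x) (z := y) hx hy
      have hone' := exists_eq_one_of_mem_span he.pos hw hQ htL ht hT hres hp hadd hadd' hpol
        hxj hx0 hx1
      have hadd'' := hb.add_mem_succ ht hadd' hone'
      have hpol' : ∀ x ∈ quadLevel v Q M (j + 2), ∀ y ∈ quadLevel v Q M (j + 1),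
          v (polar Q x y) ≤ exp (-(j + 2 : ℤ)) := fun x hx y hy => by
        refine (hb.polar_le ht hadd' hone' hx hy).trans (exp_le_exp.2 (by push_cast; lia))
      exact ⟨hadd', hone',
        mem_span_quadLevel_succ he hw hQ hT hres hp hadd hadd' hadd'' hpol hpol' hxj hx0⟩
  obtain ⟨-, ⟨z, hz, htz⟩, -⟩ := key J
  have ht0 : t z ≠ 0 := fun h => by simp [h] at htz
  have := smul_mem_quadLevel (c := (t z)⁻¹) (by simp [htz]) hz
  exact (hcon _ this.1 (by simp [ht0])).not_ge this.2

end Descent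

section Residue

open IsDedekindDomain WithZero

theorem exists_ne_zero_ternary_eq_zero {k : Type*} [Field k] [Finite k] (a : Fin 3 → Fin 3 → k) :
    ∃ c : Fin 3 → k, c ≠ 0 ∧ ∑ i, ∑ j, a i j * c i * c j = 0 := by
  classical
  have := Fintype.ofFinite k
  obtain ⟨p, hp⟩ := CharP.exists k
  let f : MvPolynomial (Fin 3) k :=
    ∑ i, ∑ j, MvPolynomial.C (a i j) * MvPolynomial.X i * MvPolynomial.X j
  have heval : ∀ c, MvPolynomial.eval c f = ∑ i, ∑ j, a i j * c i * c j := fun c => by simp [f]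
  have hdeg : f.totalDegree < Fintype.card (Fin 3) := by
    have : f.IsHomogeneous 2 := MvPolynomial.IsHomogeneous.sum _ _ _ fun i _ =>
      MvPolynomial.IsHomogeneous.sum _ _ _ fun j _ =>
        ((MvPolynomial.isHomogeneous_C _ (a i j)).mul (MvPolynomial.isHomogeneous_X _ i)).mul
          (MvPolynomial.isHomogeneous_X _ j)
    exact this.totalDegree_le.trans_lt (by simp)
  have hdvd := char_dvd_card_solutions p hdeg
  by_contra! hcon
  have : Fintype.card {x : Fin 3 → k // MvPolynomial.eval x f = 0} = 1 := by
    rw [Fintype.card_eq_one_iff]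
    refine ⟨⟨0, by rw [heval]; simp⟩, fun ⟨c, hc⟩ => ?_⟩
    rw [Subtype.mk.injEq]
    by_contra h
    exact hcon c h (by rw [← heval, hc])
  rw [this, Nat.dvd_one] at hdvd
  exact CharP.char_ne_one k p hdvd

theorem exists_root_of_odd_finrank {k l : Type*} [Field k] [Field l] [Algebra k l]
    (h : Odd (Module.finrank k l)) {β γ : k} {b : l}
    (hb : b ^ 2 + algebraMap k l β * b + algebraMap k l γ = 0) : ∃ c : k, c ^ 2 + β * c + γ = 0 := by
  have : FiniteDimensional k l := Module.finite_of_finrank_pos h.pos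
  let f : Polynomial k := .X ^ 2 + .C β * .X + .C γ
  have hf : f.natDegree = 2 := by simp only [f]; compute_degree!
  have hm : f.Monic := by simp only [f]; monicity!
  have hint : IsIntegral k b := .of_finite k b
  have hle : (minpoly k b).natDegree ≤ 2 :=
    hf ▸ Polynomial.natDegree_le_natDegree (minpoly.min k b hm (by simpa [f] using hb))
  have hodd : Odd (minpoly k b).natDegree := h.of_dvd_nat (minpoly.degree_dvd hint)
  have h1 : (minpoly k b).natDegree = 1 := by
    obtain ⟨m, hm⟩ := hodd
    lia
  obtain ⟨c, rfl⟩ := minpoly.mem_range_of_degree_eq_one k b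
    ((Polynomial.degree_eq_iff_natDegree_eq_of_pos one_pos).2 h1)
  refine ⟨c, (algebraMap k l).injective ?_⟩
  simpa using hb

variable {R K : Type*} [CommRing R] [IsDedekindDomain R] [Field K] [Algebra R K]
  [IsFractionRing R K]

theorem IsDedekindDomain.HeightOneSpectrum.exists_valuation_sub_lt_one (v : HeightOneSpectrum R)
    {x : K} (hx : v.valuation K x ≤ 1) : ∃ r : R, v.valuation K (x - algebraMap R K r) < 1 := by
  obtain ⟨r, hr⟩ := v.exists_valuation_sub_lt_of_integer hx 1
  exact ⟨r, by rwa [Valuation.map_sub_swap]⟩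

theorem Valuation.map_mul_lt_one {F : Type*} [Field F] {v : Valuation F ℤᵐ⁰} {x y : F}
    (hx : v x < 1) (hy : v y ≤ 1) : v (x * y) < 1 := by
  rw [map_mul]
  exact mul_lt_one_of_lt_of_le hx hy

theorem hasTernaryZeros_valuation (v : HeightOneSpectrum R) [Finite (R ⧸ v.asIdeal)] :
    HasTernaryZeros (v.valuation K) := by
  intro a ha
  let := Ideal.Quotient.field v.asIdeal
  choose r hr using fun i j => v.exists_valuation_sub_lt_one (ha i j)
  obtain ⟨c, hc0, hc⟩ := exists_ne_zero_ternary_eq_zero fun i j => Ideal.Quotient.mk v.asIdeal (r i j)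
  choose d hd using fun i => Ideal.Quotient.mk_surjective (c i)
  refine ⟨fun i => algebraMap R K (d i), fun i => v.valuation_le_one _, ?_, ?_⟩
  · obtain ⟨i, hi⟩ := Function.ne_iff.1 hc0
    refine ⟨i, le_antisymm (v.valuation_le_one _) (le_of_not_gt fun h => hi ?_)⟩
    rw [← hd, Pi.zero_apply, Ideal.Quotient.eq_zero_iff_mem]
    exact (v.valuation_lt_one_iff_mem _).1 h
  · have hmem : ∑ i, ∑ j, r i j * d i * d j ∈ v.asIdeal := by
      rw [← Ideal.Quotient.eq_zero_iff_mem]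
      simpa [hd] using hc
    have h1 := (v.valuation_lt_one_iff_mem (K := K) _).2 hmem
    have h2 : v.valuation K (∑ i, ∑ j, (a i j - algebraMap R K (r i j)) *
        (algebraMap R K (d i) * algebraMap R K (d j))) < 1 :=
      Valuation.map_sum_lt _ one_ne_zero fun i _ => Valuation.map_sum_lt _ one_ne_zero fun j _ =>
        Valuation.map_mul_lt_one (hr i j) (by
          rw [← map_mul]; exact v.valuation_le_one _)
    convert Valuation.map_add_lt _ h1 h2 using 2
    simp only [map_sum, map_mul, ← Finset.sum_add_distrib]
    refine Finset.sum_congr rfl fun i _ => Finset.sum_congr rfl fun j _ => ?_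
    ring

theorem residueQuadraticClosed_valuation {S L : Type*} [CommRing S] [IsDedekindDomain S] [Field L]
    [Algebra S L] [IsFractionRing S L] [Algebra K L] [Algebra R S] [Algebra R L]
    [IsScalarTower R S L] [IsScalarTower R K L] (v : HeightOneSpectrum R) (w : HeightOneSpectrum S)
    [w.asIdeal.LiesOver v.asIdeal]
    (hw : ∀ x : K, v.valuation K x < 1 → w.valuation L (algebraMap K L x) < 1)
    (hodd : Odd (v.asIdeal.inertiaDeg' w.asIdeal)) :
    ResidueQuadraticClosed (v.valuation K) (w.valuation L) := by
  intro β γ b hβ hγ hb h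
  let := Ideal.Quotient.field v.asIdeal
  let := Ideal.Quotient.field w.asIdeal
  rw [Ideal.inertiaDeg'_algebraMap] at hodd
  obtain ⟨β', hβ'⟩ := v.exists_valuation_sub_lt_one hβ
  obtain ⟨γ', hγ'⟩ := v.exists_valuation_sub_lt_one hγ
  obtain ⟨b', hb'⟩ := w.exists_valuation_sub_lt_one hb
  have hint : ∀ s : S, w.valuation L (algebraMap S L s) ≤ 1 := w.valuation_le_one
  have hcomp : ∀ x : R, algebraMap K L (algebraMap R K x) = algebraMap S L (algebraMap R S x) :=
    fun x => by rw [← IsScalarTower.algebraMap_apply, ← IsScalarTower.algebraMap_apply]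
  have hmem : b' ^ 2 + algebraMap R S β' * b' + algebraMap R S γ' ∈ w.asIdeal := by
    rw [← w.valuation_lt_one_iff_mem (K := L)]
    have h1 := Valuation.map_mul_lt_one hb' ((w.valuation L).map_add_le
      ((w.valuation L).map_add_le hb (hint b')) (hint (algebraMap R S β')))
    have h2 := Valuation.map_mul_lt_one (hw _ hβ') hb
    have h3 := (w.valuation L).map_add_lt ((w.valuation L).map_add_lt h1 h2) (hw _ hγ')
    convert (w.valuation L).map_sub_lt h h3 using 2
    simp only [map_sub, hcomp, map_add, map_mul, map_pow]
    ring
  have hroot : (Ideal.Quotient.mk w.asIdeal b') ^ 2 +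
      algebraMap (R ⧸ v.asIdeal) (S ⧸ w.asIdeal) (Ideal.Quotient.mk _ β') *
        Ideal.Quotient.mk w.asIdeal b' +
      algebraMap (R ⧸ v.asIdeal) (S ⧸ w.asIdeal) (Ideal.Quotient.mk _ γ') = 0 := by
    rw [← Ideal.Quotient.eq_zero_iff_mem] at hmem
    simpa using hmem
  obtain ⟨c, hc⟩ := exists_root_of_odd_finrank hodd hroot
  obtain ⟨c, rfl⟩ := Ideal.Quotient.mk_surjective c
  refine ⟨algebraMap R K c, v.valuation_le_one _, ?_⟩
  have hmem' : c ^ 2 + β' * c + γ' ∈ v.asIdeal := by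
    rw [← Ideal.Quotient.eq_zero_iff_mem]
    simpa using hc
  have h1 := (v.valuation_lt_one_iff_mem (K := K) _).2 hmem'
  have h2 := Valuation.map_mul_lt_one hβ' (v.valuation_le_one (K := K) c)
  convert (v.valuation K).map_add_lt ((v.valuation K).map_add_lt h1 h2) hγ' using 2
  simp only [map_add, map_mul, map_pow]
  ring

end Residue

section Completion

open IsDedekindDomain NumberField WithZero

variable {K : Type*} [Field K] [NumberField K]

theorem finite_residueField_adicCompletionIntegers (v : HeightOneSpectrum (𝓞 K)) :
    Finite (IsLocalRing.ResidueField (v.adicCompletionIntegers K)) := by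
  have hfin : Finite (𝓞 K ⧸ v.asIdeal) := Ideal.finiteQuotientOfFreeOfNeBot _ v.ne_bot
  refine Finite.of_surjective (fun q : 𝓞 K ⧸ v.asIdeal =>
    IsLocalRing.residue (v.adicCompletionIntegers K)
      (algebraMap (𝓞 K) (v.adicCompletionIntegers K) q.out)) fun y => ?_
  obtain ⟨x, rfl⟩ := IsLocalRing.residue_surjective y
  have hnhds : {y : v.adicCompletion K | Valued.v (y - x) < 1} ∈ nhds (x : v.adicCompletion K) := by
    rw [Valued.mem_nhds]
    refine ⟨1, fun y hy => ?_⟩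
    simpa [Valuation.restrict_lt_iff_lt_embedding] using hy
  obtain ⟨_, hk, k, rfl⟩ := mem_closure_iff_nhds.1 (v.denseRange_algebraMap K x) _ hnhds
  have hk1 : v.valuation K k ≤ 1 := by
    have hx : Valued.v (x : v.adicCompletion K) ≤ 1 :=
      (HeightOneSpectrum.mem_adicCompletionIntegers _ _ _).1 x.2
    have h := Valued.v.map_add_le (le_of_lt hk) hx
    rw [sub_add_cancel] at h
    exact (HeightOneSpectrum.valuedAdicCompletion_eq_valuation' v k).symm.trans_le h
  obtain ⟨r, hr⟩ := v.exists_valuation_sub_lt_one hk1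
  refine ⟨Ideal.Quotient.mk _ r, ?_⟩
  set s := (Ideal.Quotient.mk v.asIdeal r).out
  have hs : v.valuation K (algebraMap (𝓞 K) K s - algebraMap (𝓞 K) K r) < 1 := by
    rw [← map_sub, HeightOneSpectrum.valuation_lt_one_iff_mem, ← Ideal.Quotient.eq]
    exact Quotient.out_eq' _
  have hsk : v.valuation K (algebraMap (𝓞 K) K s - k) < 1 := by
    rw [Valuation.map_sub_swap] at hr
    simpa using Valuation.map_add_lt _ hs hr
  have hsx : Valued.v (algebraMap K (v.adicCompletion K) (algebraMap (𝓞 K) K s) - x) < 1 := by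
    have h : Valued.v (algebraMap K (v.adicCompletion K) (algebraMap (𝓞 K) K s - k)) < 1 :=
      (HeightOneSpectrum.valuedAdicCompletion_eq_valuation' v _).trans_lt hsk
    have h' := Valuation.map_add_lt Valued.v h hk
    rwa [map_sub, sub_add_sub_cancel] at h'
  rw [← sub_eq_zero, ← map_sub, IsLocalRing.residue_eq_zero_iff, IsLocalRing.mem_maximalIdeal,
    mem_nonunits_iff, HeightOneSpectrum.adicCompletionIntegers.isUnit_iff_valued_eq_one]
  exact ne_of_lt hsx

theorem compactSpace_adicCompletionIntegers (v : HeightOneSpectrum (𝓞 K)) :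
    CompactSpace (v.adicCompletionIntegers K) := by
  refine Valued.integer.compactSpace_iff_completeSpace_and_isDiscreteValuationRing_and_finite_residueField.2 ⟨?_, ?_, ?_⟩
  · exact (Valued.isClosed_integer (v.adicCompletion K)).completeSpace_coe
  · exact inferInstanceAs (IsDiscreteValuationRing (v.adicCompletionIntegers K))
  · exact finite_residueField_adicCompletionIntegers v

theorem exists_eval_eq_of_forall_approx (v : HeightOneSpectrum (𝓞 K)) {n : ℕ}
    (Q : MvPolynomial (Fin n) (𝓞 K)) (a : K)
    (h : ∀ J : ℕ, ∃ x : Fin n → K, (∀ i, v.valuation K (x i) ≤ 1) ∧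
      v.valuation K (MvPolynomial.eval₂ (algebraMap (𝓞 K) K) x Q - a) ≤ exp (-(J : ℤ))) :
    ∃ x : Fin n → v.adicCompletion K, (∀ i, x i ∈ v.adicCompletionIntegers K) ∧
      MvPolynomial.eval₂ ((algebraMap K (v.adicCompletion K)).comp (algebraMap (𝓞 K) K)) x Q
        = algebraMap K (v.adicCompletion K) a := by
  have := compactSpace_adicCompletionIntegers v
  let C : Set (Fin n → v.adicCompletion K) :=
    Set.univ.pi fun _ => (v.adicCompletionIntegers K : Set (v.adicCompletion K))
  have hC : IsCompact C := isCompact_univ_pi fun _ => isCompact_iff_compactSpace.2 this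
  let f : (Fin n → v.adicCompletion K) → v.adicCompletion K := fun x =>
    MvPolynomial.eval₂ ((algebraMap K (v.adicCompletion K)).comp (algebraMap (𝓞 K) K)) x Q
  have hf : Continuous f := by
    simp only [f, ← MvPolynomial.eval_map]
    exact MvPolynomial.continuous_eval _
  have hmem : algebraMap K (v.adicCompletion K) a ∈ closure (f '' C) := by
    rw [mem_closure_iff_nhds]
    intro s hs
    obtain ⟨γ, hγ⟩ := Valued.mem_nhds.1 hs
    obtain ⟨J, hJ⟩ := WithZero.exists_exp_neg_natCast_lt
      (x := MonoidWithZeroHom.ValueGroup₀.embedding γ.1) (by simp)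
    obtain ⟨x, hx, hxa⟩ := h J
    refine ⟨f fun i => algebraMap K _ (x i), hγ ?_, _, fun i _ => ?_, rfl⟩
    · rw [Set.mem_ofPred_eq, Valuation.restrict_lt_iff_lt_embedding]
      refine lt_of_le_of_lt ?_ hJ
      have : f (fun i => algebraMap K _ (x i)) - algebraMap K (v.adicCompletion K) a =
          algebraMap K (v.adicCompletion K)
            (MvPolynomial.eval₂ (algebraMap (𝓞 K) K) x Q - a) := by
        rw [map_sub, MvPolynomial.eval₂_comp_left]
        rfl
      rw [this]
      exact (HeightOneSpectrum.valuedAdicCompletion_eq_valuation' v _).trans_le hxa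
    · exact (HeightOneSpectrum.mem_adicCompletionIntegers _ _ _).2
        ((HeightOneSpectrum.valuedAdicCompletion_eq_valuation' v _).trans_le (hx i))
  rw [(hC.image hf).isClosed.closure_eq] at hmem
  obtain ⟨x, hx, hxa⟩ := hmem
  exact ⟨x, fun i => hx i trivial, hxa⟩

end Completion

section HomogeneousQuadratic

theorem MvPolynomial.IsHomogeneous.exists_eq_sum_sum {R : Type*} [CommRing R] {n : ℕ}
    {Q : MvPolynomial (Fin n) R} (hQ : Q.IsHomogeneous 2) :
    ∃ A : Fin n → Fin n → R, Q = ∑ i, ∑ j, .C (A i j) * .X i * .X j := by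
  suffices Q ∈ Submodule.span R
      (Set.range fun p : Fin n × Fin n => (.X p.1 * .X p.2 : MvPolynomial (Fin n) R)) by
    rw [Submodule.mem_span_range_iff_exists_fun] at this
    obtain ⟨c, rfl⟩ := this
    exact ⟨fun i j => c (i, j), by
      simp [Fintype.sum_prod_type, MvPolynomial.smul_eq_C_mul, mul_assoc]⟩
  rw [Q.as_sum]
  refine Submodule.sum_mem _ fun d hd => ?_
  have hd2 : d.degree = 2 := by
    rw [Finsupp.degree_eq_weight_one]
    exact hQ (MvPolynomial.mem_support_iff.1 hd)
  have : ∃ i j, d = .single i 1 + .single j 1 := by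
    obtain ⟨i, hi⟩ : ∃ i, d i ≠ 0 := by
      by_contra! h
      have : d = 0 := Finsupp.ext h
      simp [this] at hd2
    obtain ⟨e, rfl⟩ : ∃ e, d = .single i 1 + e :=
      exists_add_of_le (by simpa [Finsupp.single_le_iff, Nat.one_le_iff_ne_zero] using hi)
    have he : e.degree = 1 := by
      simp only [map_add, Finsupp.degree_single] at hd2
      lia
    obtain ⟨j, hj⟩ : ∃ i, e i ≠ 0 := by
      by_contra! h
      have : e = 0 := Finsupp.ext h
      simp [this] at he
    obtain ⟨f, rfl⟩ : ∃ f, e = .single j 1 + f :=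
      exists_add_of_le (by simpa [Finsupp.single_le_iff, Nat.one_le_iff_ne_zero] using hj)
    have hf : f.degree = 0 := by
      simp only [map_add, Finsupp.degree_single] at he
      lia
    rw [Finsupp.degree_eq_zero_iff] at hf
    exact ⟨i, j, by simp [hf]⟩
  obtain ⟨i, j, hij⟩ := this
  have : MvPolynomial.monomial d (Q.coeff d) = Q.coeff d • (.X i * .X j) := by
    rw [MvPolynomial.X, MvPolynomial.X, MvPolynomial.monomial_mul, ← hij]
    simp [MvPolynomial.smul_monomial]
  rw [this]
  exact Submodule.smul_mem _ _ (Submodule.subset_span ⟨(i, j), rfl⟩)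

end HomogeneousQuadratic

section RealPlace

theorem Polynomial.exists_isRoot_of_odd_natDegree_real {f : Polynomial ℝ} (hf : Odd f.natDegree) :
    ∃ y, f.IsRoot y := by
  induction hn : f.natDegree using Nat.strong_induction_on generalizing f with
  | h n ih =>
    subst hn
    obtain ⟨g, hg, h, rfl⟩ := WfDvdMonoid.exists_irreducible_factor (a := f)
      (fun hu => by simp [natDegree_eq_zero_of_isUnit hu] at hf) (fun h0 => by simp [h0] at hf)
    have hh : h ≠ 0 := fun h0 => by simp [h0] at hf
    have hg2 := hg.natDegree_le_two
    have hg0 := hg.natDegree_pos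
    rw [natDegree_mul hg.ne_zero hh] at hf ih
    by_cases h1 : g.natDegree = 1
    · obtain ⟨y, hy⟩ := exists_root_of_degree_eq_one
        ((degree_eq_iff_natDegree_eq_of_pos one_pos).2 h1)
      exact ⟨y, hy.dvd (dvd_mul_right _ _)⟩
    · have : g.natDegree = 2 := by lia
      rw [this] at ih hf
      obtain ⟨y, hy⟩ := ih h.natDegree (by lia) (f := h)
        (by rwa [add_comm, Nat.odd_add, iff_true_right even_two] at hf) rfl
      exact ⟨y, hy.dvd (dvd_mul_left _ _)⟩

theorem exists_ringHom_real_extension {K L : Type*} [Field K] [Field L] [Algebra K L] [CharZero K]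
    (h : Odd (Module.finrank K L)) (σ : K →+* ℝ) :
    ∃ τ : L →+* ℝ, τ.comp (algebraMap K L) = σ := by
  have : FiniteDimensional K L := Module.finite_of_finrank_pos h.pos
  let := σ.toAlgebra
  let pb := Field.powerBasisOfFiniteOfSeparable K L
  have hdeg : Odd ((minpoly K pb.gen).map σ).natDegree := by
    rw [Polynomial.natDegree_map, pb.natDegree_minpoly, ← pb.finrank]
    exact h
  obtain ⟨y, hy⟩ : ∃ y, ((minpoly K pb.gen).map σ).IsRoot y :=
    Polynomial.exists_isRoot_of_odd_natDegree_real hdeg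
  have hy' : Polynomial.aeval y (minpoly K pb.gen) = 0 := by
    rw [Polynomial.aeval_def, ← Polynomial.eval_map]
    exact hy
  exact ⟨(pb.lift y hy').toRingHom, (pb.lift y hy').comp_algebraMap⟩

end RealPlace

section FinitePlace

open IsDedekindDomain NumberField WithZero

theorem exists_liesOver_odd {K L : Type*} [Field K] [NumberField K] [Field L] [NumberField L]
    [Algebra K L] (h : Odd (Module.finrank K L)) (v : HeightOneSpectrum (𝓞 K)) :
    ∃ w : HeightOneSpectrum (𝓞 L), w.asIdeal.LiesOver v.asIdeal ∧
      Odd (v.asIdeal.ramificationIdx' w.asIdeal) ∧ Odd (v.asIdeal.inertiaDeg' w.asIdeal) := by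
  have hmax : v.asIdeal.IsMaximal := v.isMaximal
  have hsum := Ideal.sum_ramification_inertia (𝓞 L) K L (p := v.asIdeal) v.ne_bot
  obtain ⟨P, hP, hodd⟩ : ∃ P ∈ IsDedekindDomain.primesOverFinset v.asIdeal (𝓞 L),
      Odd (v.asIdeal.ramificationIdx' P * v.asIdeal.inertiaDeg' P) := by
    by_contra! hcon
    rw [← hsum] at h
    exact Nat.not_even_iff_odd.2 h
      (Finset.even_sum _ fun P hP => Nat.not_odd_iff_even.1 (hcon P hP))
  rw [IsDedekindDomain.mem_primesOverFinset_iff v.ne_bot] at hP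
  obtain ⟨hprime, hover⟩ := hP
  exact ⟨⟨P, hprime, Ideal.ne_bot_of_liesOver_of_ne_bot v.ne_bot P⟩, hover, Nat.odd_mul.1 hodd⟩

/-- The quadratic form `∑ A i j x i x j - a s²` in the variables `(x, s)`. -/
def affineQuadraticForm {K : Type*} [Field K] {n : ℕ} (A : Fin n → Fin n → K) (a : K) :
    QuadraticForm K ((Fin n → K) × K) :=
  (∑ i, ∑ j, A i j • QuadraticMap.linMulLin
      (LinearMap.proj i ∘ₗ LinearMap.fst K (Fin n → K) K)
      (LinearMap.proj j ∘ₗ LinearMap.fst K (Fin n → K) K)) -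
    a • QuadraticMap.linMulLin (LinearMap.snd K (Fin n → K) K) (LinearMap.snd K (Fin n → K) K)

theorem affineQuadraticForm_apply {K : Type*} [Field K] {n : ℕ} (A : Fin n → Fin n → K) (a : K)
    (x : (Fin n → K) × K) : affineQuadraticForm A a x =
      ∑ i, ∑ j, A i j * (x.1 i * x.1 j) - a * (x.2 * x.2) := by
  simp [affineQuadraticForm]

theorem affineQuadraticForm_map {K L : Type*} [Field K] [Field L] (f : K →+* L) {n : ℕ}
    (A : Fin n → Fin n → K) (a : K) (x : (Fin n → K) × K) :
    affineQuadraticForm (fun i j => f (A i j)) (f a) (fun i => f (x.1 i), f x.2) =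
      f (affineQuadraticForm A a x) := by
  simp [affineQuadraticForm_apply]

/-- The vectors of `Kⁿ × K` with integral coordinates. -/
def integralVectors {K : Type*} [Field K] (v : Valuation K ℤᵐ⁰) (n : ℕ) :
    Submodule v.integer ((Fin n → K) × K) where
  carrier := {x | (∀ i, v (x.1 i) ≤ 1) ∧ v x.2 ≤ 1}
  zero_mem' := by simp
  add_mem' hx hy := ⟨fun i => v.map_add_le (hx.1 i) (hy.1 i), v.map_add_le hx.2 hy.2⟩
  smul_mem' c x hx := by
    have hc : v (c : K) ≤ 1 := c.2
    refine ⟨fun i => ?_, ?_⟩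
    · change v ((c : K) * x.1 i) ≤ 1
      rw [map_mul]
      exact mul_le_one' hc (hx.1 i)
    · change v ((c : K) * x.2) ≤ 1
      rw [map_mul]
      exact mul_le_one' hc hx.2

theorem affineQuadraticForm_le_one {K : Type*} [Field K] {v : Valuation K ℤᵐ⁰} {n : ℕ}
    {A : Fin n → Fin n → K} {a : K} (hA : ∀ i j, v (A i j) ≤ 1) (ha : v a ≤ 1)
    {x : (Fin n → K) × K} (hx : x ∈ integralVectors v n) : v (affineQuadraticForm A a x) ≤ 1 := by
  rw [affineQuadraticForm_apply]
  change _ ∈ v.integer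
  have h1 : ∀ i, x.1 i ∈ v.integer := hx.1
  have h2 : x.2 ∈ v.integer := hx.2
  have hA : ∀ i j, A i j ∈ v.integer := hA
  have ha : a ∈ v.integer := ha
  exact sub_mem (sum_mem fun i _ => sum_mem fun j _ => mul_mem (hA i j) (mul_mem (h1 i) (h1 j)))
    (mul_mem ha (mul_mem h2 h2))

theorem mem_span_integralVectors {K L : Type*} [Field K] [Field L] [Algebra K L]
    {v : Valuation K ℤᵐ⁰} {w : Valuation L ℤᵐ⁰} {n : ℕ} {x : (Fin n → L) × L}
    (hx : x ∈ integralVectors w n) (ι : (Fin n → K) × K →ₗ[K] (Fin n → L) × L)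
    (hι : ∀ x, ι x = (fun i => algebraMap K L (x.1 i), algebraMap K L x.2)) :
    x ∈ Submodule.span w.integer (ι '' integralVectors v n) := by
  classical
  have key : x = ∑ i, (⟨x.1 i, hx.1 i⟩ : w.integer) • ι (Pi.single i 1, 0) +
      (⟨x.2, hx.2⟩ : w.integer) • ι (0, 1) := by
    simp only [hι, integer_smul_eq]
    ext j
    · simp [Finset.sum_apply, Pi.single_apply, Prod.fst_sum]
    · simp [Prod.snd_sum]
  rw [key]
  refine Submodule.add_mem _ (Submodule.sum_mem _ fun i _ => ?_) ?_
  · refine Submodule.smul_mem _ _ (Submodule.subset_span ⟨_, ⟨fun j => ?_, by simp⟩, rfl⟩)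
    by_cases h : j = i <;> simp [h]
  · exact Submodule.smul_mem _ _ (Submodule.subset_span ⟨_, ⟨fun j => by simp, by simp⟩, rfl⟩)

theorem exists_adicCompletion_eval_eq_of_odd {K L : Type*} [Field K] [NumberField K] [Field L]
    [NumberField L] [Algebra K L] (h : Odd (Module.finrank K L)) {n : ℕ}
    {Q : MvPolynomial (Fin n) (𝓞 K)} (hQ : Q.IsHomogeneous 2) {a : 𝓞 K} {x : Fin n → 𝓞 L}
    (hx : MvPolynomial.aeval x Q = algebraMap (𝓞 K) (𝓞 L) a) (v : HeightOneSpectrum (𝓞 K)) :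
    ∃ x : Fin n → v.adicCompletion K, (∀ i, x i ∈ v.adicCompletionIntegers K) ∧
      MvPolynomial.eval₂ ((algebraMap K (v.adicCompletion K)).comp (algebraMap (𝓞 K) K)) x Q
        = algebraMap K (v.adicCompletion K) (algebraMap (𝓞 K) K a) := by
  obtain ⟨w, hover, he, hf⟩ := exists_liesOver_odd h v
  have : Finite (𝓞 K ⧸ v.asIdeal) := Ideal.finiteQuotientOfFreeOfNeBot _ v.ne_bot
  have hw (x : K) := (HeightOneSpectrum.valuation_liesOver L v w x).symm
  have hw1 (x : K) (hx : v.valuation K x < 1) : w.valuation L (algebraMap K L x) < 1 := by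
    rw [hw]
    exact pow_lt_one₀ zero_le hx he.pos.ne'
  obtain ⟨A, rfl⟩ := hQ.exists_eq_sum_sum
  obtain ⟨p, hp⟩ := v.valuation_exists_uniformizer K
  let ι : (Fin n → K) × K →ₗ[K] (Fin n → L) × L :=
    (LinearMap.compLeft (Algebra.linearMap K L) (Fin n)).prodMap (Algebra.linearMap K L)
  let B := fun i j => algebraMap (𝓞 K) K (A i j)
  let b := algebraMap (𝓞 K) K a
  let y : (Fin n → L) × L := (fun i => algebraMap (𝓞 L) L (x i), 1)
  have hy : y ∈ integralVectors (w.valuation L) n :=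
    ⟨fun i => w.valuation_le_one (x i), by simp [y]⟩
  have hy0 : affineQuadraticForm (fun i j => algebraMap K L (B i j)) (algebraMap K L b) y = 0 := by
    have := congrArg (algebraMap (𝓞 L) L) hx
    simp only [map_sum, map_mul, MvPolynomial.aeval_C, MvPolynomial.aeval_X,
      ← IsScalarTower.algebraMap_apply] at this
    simp [affineQuadraticForm_apply, y, B, b, ← IsScalarTower.algebraMap_apply, ← this, mul_assoc]
  refine exists_eval_eq_of_forall_approx v _ _ fun J => ?_
  obtain ⟨u, hu, hu1, huJ⟩ := exists_quad_le_of_extension (v := v.valuation K) (w := w.valuation L)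
    (Q := affineQuadraticForm B b) (M := integralVectors (v.valuation K) n)
    (t := LinearMap.snd K _ _) (tL := LinearMap.snd L (Fin n → L) L) (ι := ι) he hw
    (fun x => affineQuadraticForm_map (algebraMap K L) B b x) (fun x => rfl) (fun x hx => hx.2)
    (fun x hx => affineQuadraticForm_le_one (fun i j => v.valuation_le_one _)
      (v.valuation_le_one _) hx) ⟨(0, 1), ⟨by simp, by simp⟩, by simp⟩
    (hasTernaryZeros_valuation v) (residueQuadraticClosed_valuation v w hw1 hf) hp
    (mem_span_integralVectors hy ι fun _ => rfl) hy0 rfl J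
  refine ⟨u.1, hu.1, ?_⟩
  convert huJ using 2
  have hu1 : u.2 = 1 := hu1
  simp [affineQuadraticForm_apply, hu1, B, b, mul_assoc, MvPolynomial.eval₂_sum]

end FinitePlace

open NumberField MvPolynomial IsDedekindDomain

theorem eval₂_comp_algebraMap_eq {K L : Type*} [Field K] [Field L] [Algebra K L] {F : Type*}
    [Field F] {n : ℕ} {Q : MvPolynomial (Fin n) (𝓞 K)} {a : 𝓞 K} {x : Fin n → 𝓞 L}
    (hx : aeval x Q = algebraMap (𝓞 K) (𝓞 L) a) (τ : L →+* F) :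
    eval₂ ((τ.comp (algebraMap K L)).comp (algebraMap (𝓞 K) K))
      (fun i => τ (algebraMap (𝓞 L) L (x i))) Q =
        τ.comp (algebraMap K L) (algebraMap (𝓞 K) K a) := by
  have := congrArg (τ.comp (algebraMap (𝓞 L) L)) hx
  rw [aeval_def, eval₂_comp_left] at this
  exact this

/-- If `K` is a number field and `Q` a quadratic form in `n` variables over
`𝓞 K` which is regular (every element of `𝓞 K` locally represented by `Q` — i.e. represented
over the valuation ring of every nonarchimedean completion and over every archimedean
completion — is represented over `𝓞 K`), then for every extension `L/K` of number fields of
odd degree one has `Q(𝓞 L) ∩ 𝓞 K = Q(𝓞 K)`. -/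
theorem statement1
    (K : Type) [Field K] [NumberField K]
    (n : ℕ) (Q : MvPolynomial (Fin n) (𝓞 K)) (hQ : Q.IsHomogeneous 2)
    (hregular : ∀ a : 𝓞 K,
      ((∀ v : HeightOneSpectrum (𝓞 K),
        ∃ x : Fin n → v.adicCompletion K,
          (∀ i, x i ∈ v.adicCompletionIntegers K) ∧
          eval₂ ((algebraMap K (v.adicCompletion K)).comp (algebraMap (𝓞 K) K)) x Q
            = algebraMap K (v.adicCompletion K) (algebraMap (𝓞 K) K a)) ∧
      (∀ σ : K →+* ℝ,
        ∃ x : Fin n → ℝ,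
          eval₂ (σ.comp (algebraMap (𝓞 K) K)) x Q = σ (algebraMap (𝓞 K) K a)) ∧
      (∀ σ : K →+* ℂ,
        ∃ x : Fin n → ℂ,
          eval₂ (σ.comp (algebraMap (𝓞 K) K)) x Q = σ (algebraMap (𝓞 K) K a))) →
      ∃ x : Fin n → 𝓞 K, eval x Q = a) :
    ∀ (L : Type) [Field L] [NumberField L] [Algebra K L],
      Odd (Module.finrank K L) →
      ∀ a : 𝓞 K,
        (∃ x : Fin n → 𝓞 L, aeval x Q = algebraMap (𝓞 K) (𝓞 L) a) ↔
        (∃ x : Fin n → 𝓞 K, eval x Q = a) := by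
  intro L _ _ _ hodd a
  refine ⟨fun ⟨x, hx⟩ => hregular a ⟨?_, ?_, ?_⟩, fun ⟨x, hx⟩ => ?_⟩
  · exact exists_adicCompletion_eval_eq_of_odd hodd hQ hx
  · intro σ
    obtain ⟨τ, rfl⟩ := exists_ringHom_real_extension hodd σ
    exact ⟨_, eval₂_comp_algebraMap_eq hx τ⟩
  · intro σ
    obtain ⟨τ, rfl⟩ : ∃ τ : L →+* ℂ, τ.comp (algebraMap K L) = σ := by
      let := σ.toAlgebra
      exact ⟨(IsAlgClosed.lift : L →ₐ[K] ℂ).toRingHom, AlgHom.comp_algebraMap _⟩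
    exact ⟨_, eval₂_comp_algebraMap_eq hx τ⟩
  · refine ⟨fun i => algebraMap (𝓞 K) (𝓞 L) (x i), ?_⟩
    have := eval₂_comp_left (algebraMap (𝓞 K) (𝓞 L)) (RingHom.id _) x Q
    rw [← hx, aeval_def]
    exact this.symm
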